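/- Let r ∈ ℝ and suppose there is an open interval I containing r on which F₁ is finite, and that F₁ is differentiable at r with derivative F₁'(r). Then for every ε > 0 the Moreau–Yosida regularization F_{1,ε} is differentiable at r, |F'_{1,ε}(r)| increases monotonically to |F₁'(r)| as ε decreases to 0; that is, for 0 < ε₁ ≤ ε₂ one has |F'_{1,ε₂}(r)| ≤ |F'_{1,ε₁}(r)| ≤ |F₁'(r)|, and lim_{ε → 0⁺} |F'_{1,ε}(r)| = |F₁'(r)|. -/

import Mathlib

open Filter Set ENNReal

/-- The Moreau–Yosida regularization of an extended-real-valued function `F : ℝ → [0,+∞]`: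
`F_ε(r) := inf_{s ∈ ℝ} ( (1/(2ε))·(s−r)² + F(s) )`, the infimum being taken in `[0,+∞]`. -/
noncomputable def yosida (F : ℝ → ℝ≥0∞) (ε : ℝ) (r : ℝ) : ℝ≥0∞ :=
  ⨅ s : ℝ, ENNReal.ofReal ((1 / (2 * ε)) * (s - r) ^ 2) + F s

/-- Convexity read through `toReal`. -/
lemma conv_real (F : ℝ → ℝ≥0∞)
    (hconv : ∀ x y t : ℝ, 0 ≤ t → t ≤ 1 →
      F (t * x + (1 - t) * y) ≤ ENNReal.ofReal t * F x + ENNReal.ofReal (1 - t) * F y)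
    (x y t : ℝ) (ht0 : 0 ≤ t) (ht1 : t ≤ 1) (hx : F x ≠ ⊤) (hy : F y ≠ ⊤) :
    F (t * x + (1 - t) * y) ≠ ⊤ ∧
    (F (t * x + (1 - t) * y)).toReal ≤ t * (F x).toReal + (1 - t) * (F y).toReal := by
  have h := hconv x y t ht0 ht1
  have e : ENNReal.ofReal t * F x + ENNReal.ofReal (1 - t) * F y
      = ENNReal.ofReal (t * (F x).toReal + (1 - t) * (F y).toReal) := by
    rw [ENNReal.ofReal_add (mul_nonneg ht0 toReal_nonneg)
      (mul_nonneg (by linarith) toReal_nonneg), ENNReal.ofReal_mul ht0,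
      ENNReal.ofReal_mul (by linarith), ENNReal.ofReal_toReal hx, ENNReal.ofReal_toReal hy]
  rw [e] at h
  refine ⟨ne_top_of_le_ne_top ofReal_ne_top h, ?_⟩
  exact ENNReal.toReal_le_of_le_ofReal (add_nonneg (mul_nonneg ht0 toReal_nonneg)
      (mul_nonneg (by linarith) toReal_nonneg)) h

/-- Existence of the minimizer. -/
lemma exists_prox (F : ℝ → ℝ≥0∞) (hlsc : LowerSemicontinuous F) (h0 : F 0 = 0)
    (ε : ℝ) (hε : 0 < ε) (x : ℝ) :
    ∃ J : ℝ, ∀ s : ℝ, ENNReal.ofReal ((1 / (2 * ε)) * (J - x) ^ 2) + F J ≤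
      ENNReal.ofReal ((1 / (2 * ε)) * (s - x) ^ 2) + F s := by
  have hl : LowerSemicontinuous
      (fun s : ℝ => ENNReal.ofReal ((1 / (2 * ε)) * (s - x) ^ 2) + F s) := by
    apply LowerSemicontinuous.add _ hlsc
    apply Continuous.lowerSemicontinuous
    exact ENNReal.continuous_ofReal.comp (by fun_prop)
  have h0m : (0:ℝ) ∈ Icc (x - |x|) (x + |x|) :=
    ⟨by linarith [le_abs_self x], by linarith [neg_abs_le x]⟩
  obtain ⟨J, hJ, hmin⟩ := (hl.lowerSemicontinuousOn (Icc (x - |x|) (x + |x|))).exists_isMinOn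
    ⟨0, h0m⟩ isCompact_Icc
  refine ⟨J, fun s => ?_⟩
  by_cases hs : s ∈ Icc (x - |x|) (x + |x|)
  · exact hmin hs
  · refine (hmin h0m).trans ?_
    simp only [h0, add_zero]
    refine le_trans ?_ le_self_add
    apply ENNReal.ofReal_le_ofReal
    apply mul_le_mul_of_nonneg_left _ (by positivity)
    apply sq_le_sq.mpr
    by_contra! hc
    apply hs
    rw [zero_sub, abs_neg, abs_lt] at hc
    exact ⟨by linarith, by linarith⟩

lemma yosida_key (F : ℝ → ℝ≥0∞)
    (hconv : ∀ x y t : ℝ, 0 ≤ t → t ≤ 1 →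
      F (t * x + (1 - t) * y) ≤ ENNReal.ofReal t * F x + ENNReal.ofReal (1 - t) * F y)
    (hlsc : LowerSemicontinuous F) (h0 : F 0 = 0)
    (ε : ℝ) (hε : 0 < ε) (x : ℝ) :
    ∃ p : ℝ, F (x - ε * p) ≠ ⊤ ∧ HasDerivAt (fun z : ℝ => (yosida F ε z).toReal) p x ∧
      ∀ y, F y ≠ ⊤ → (F (x - ε * p)).toReal + p * (y - (x - ε * p)) ≤ (F y).toReal := by
  obtain ⟨J, hJ⟩ := exists_prox F hlsc h0 ε hε x
  obtain ⟨p, rfl⟩ : ∃ p, J = x - ε * p := ⟨(x - J) / ε, by field_simp; ring⟩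
  have hfin : F (x - ε * p) ≠ ⊤ := by
    have h := hJ 0
    rw [h0, add_zero] at h
    exact ne_top_of_le_ne_top ofReal_ne_top (le_add_self.trans h)
  have hreal : ∀ z s, F s ≠ ⊤ → ENNReal.ofReal ((1 / (2 * ε)) * (s - z) ^ 2) + F s
      = ENNReal.ofReal ((1 / (2 * ε)) * (s - z) ^ 2 + (F s).toReal) := by
    intro z s hs
    rw [ENNReal.ofReal_add (by positivity) toReal_nonneg, ENNReal.ofReal_toReal hs]
  have hJr : ∀ s, F s ≠ ⊤ → (1 / (2 * ε)) * (x - ε * p - x) ^ 2 + (F (x - ε * p)).toReal ≤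
      (1 / (2 * ε)) * (s - x) ^ 2 + (F s).toReal := by
    intro s hs
    have h := hJ s
    rw [hreal x s hs, hreal x _ hfin] at h
    exact (ENNReal.ofReal_le_ofReal_iff (by positivity)).1 h
  have hsub : ∀ y, F y ≠ ⊤ →
      (F (x - ε * p)).toReal + p * (y - (x - ε * p)) ≤ (F y).toReal := by
    intro y hy
    have hk : ∀ t ∈ Ioo (0:ℝ) 1, (F (x - ε * p)).toReal + p * (y - (x - ε * p)) ≤
        (F y).toReal + t * ((1 / (2 * ε)) * (y - (x - ε * p)) ^ 2) := by
      intro t ht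
      obtain ⟨h1, h2⟩ := conv_real F hconv y (x - ε * p) t ht.1.le ht.2.le hy hfin
      have h3 := (hJr _ h1).trans (add_le_add_right h2 _)
      have e : (1 / (2 * ε)) * (t * y + (1 - t) * (x - ε * p) - x) ^ 2 =
          (1 / (2 * ε)) * (x - ε * p - x) ^ 2 - t * (p * (y - (x - ε * p)))
          + t * (t * ((1 / (2 * ε)) * (y - (x - ε * p)) ^ 2)) := by
        field_simp
        ring
      rw [e] at h3
      refine le_of_mul_le_mul_left ?_ ht.1
      linarith
    have hlim : Tendsto (fun t : ℝ =>
        (F y).toReal + t * ((1 / (2 * ε)) * (y - (x - ε * p)) ^ 2))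
        (nhdsWithin 0 (Ioi 0)) (nhds (F y).toReal) := by
      have : Continuous (fun t : ℝ =>
        (F y).toReal + t * ((1 / (2 * ε)) * (y - (x - ε * p)) ^ 2)) := by fun_prop
      have h := (this.tendsto 0).mono_left (nhdsWithin_le_nhds (s := Ioi 0))
      simpa using h
    refine ge_of_tendsto hlim ?_
    filter_upwards [Ioo_mem_nhdsGT (zero_lt_one' ℝ)] with t ht using hk t ht
  refine ⟨p, hfin, ?_, hsub⟩
  set Y0 : ℝ := ε * p ^ 2 / 2 + (F (x - ε * p)).toReal with hY0
  have hup : ∀ z, yosida F ε z ≤ ENNReal.ofReal (Y0 + p * (z - x) + (1 / (2 * ε)) * (z - x) ^ 2) := by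
    intro z
    refine (iInf_le _ (x - ε * p)).trans ?_
    rw [hreal z _ hfin]
    apply le_of_eq
    congr 1
    rw [hY0]
    field_simp
    ring
  have hlow : ∀ z, ENNReal.ofReal (Y0 + p * (z - x)) ≤ yosida F ε z := by
    intro z
    refine le_iInf fun s => ?_
    by_cases hs : F s = ⊤
    · simp [hs]
    rw [hreal z s hs]
    apply ENNReal.ofReal_le_ofReal
    have h := hsub s hs
    have e : (1 / (2 * ε)) * (s - z + ε * p) ^ 2 =
      (1 / (2 * ε)) * (s - z) ^ 2 + p * (s - z) + ε * p ^ 2 / 2 := by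
      field_simp
      ring
    have e2 : 0 ≤ (1 / (2 * ε)) * (s - z + ε * p) ^ 2 := by positivity
    rw [hY0]
    nlinarith
  have hne : ∀ z, yosida F ε z ≠ ⊤ := fun z => ne_top_of_le_ne_top ofReal_ne_top (hup z)
  have hlr : ∀ z, Y0 + p * (z - x) ≤ (yosida F ε z).toReal := fun z =>
    (ENNReal.ofReal_le_iff_le_toReal (hne z)).1 (hlow z)
  have hur : ∀ z, (yosida F ε z).toReal ≤ Y0 + p * (z - x) + (1 / (2 * ε)) * (z - x) ^ 2 := by
    intro z
    refine ENNReal.toReal_le_of_le_ofReal ?_ (hup z)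
    have e : Y0 + p * (z - x) + (1 / (2 * ε)) * (z - x) ^ 2 =
      (F (x - ε * p)).toReal + (1 / (2 * ε)) * (z - x + ε * p) ^ 2 := by
      rw [hY0]
      field_simp
      ring
    rw [e]
    positivity
  have hx : (yosida F ε x).toReal = Y0 := by
    have h1 := hlr x
    have h2 := hur x
    simp only [sub_self, mul_zero, add_zero, ne_eq, OfNat.ofNat_ne_zero, not_false_eq_true,
      zero_pow] at h1 h2
    linarith
  rw [hasDerivAt_iff_isLittleO]
  have hO : (fun z => (yosida F ε z).toReal - (yosida F ε x).toReal - (z - x) • p)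
      =O[nhds x] (fun z => (z - x) ^ 2) := by
    apply Asymptotics.IsBigO.of_bound (1 / (2 * ε))
    filter_upwards with z
    have h1 := hlr z
    have h2 := hur z
    rw [hx, Real.norm_eq_abs, Real.norm_eq_abs, abs_of_nonneg (sq_nonneg (z - x)), smul_eq_mul,
      abs_le]
    constructor <;> nlinarith
  refine hO.trans_isLittleO ?_
  simpa only [Real.norm_eq_abs, sq_abs] using Asymptotics.isLittleO_pow_sub_sub x (m := 2) (by norm_num)

lemma deriv_subgradient (F : ℝ → ℝ≥0∞)
    (hconv : ∀ x y t : ℝ, 0 ≤ t → t ≤ 1 →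
      F (t * x + (1 - t) * y) ≤ ENNReal.ofReal t * F x + ENNReal.ofReal (1 - t) * F y)
    (r : ℝ) (hr : F r ≠ ⊤)
    (D : ℝ) (hD : HasDerivAt (fun x : ℝ => (F x).toReal) D r) (y : ℝ) (hy : F y ≠ ⊤) :
    (F r).toReal + D * (y - r) ≤ (F y).toReal := by
  have hlin : HasDerivAt (fun t : ℝ => t * y + (1 - t) * r) (y - r) 0 := by
    have h := ((hasDerivAt_id (0:ℝ)).mul_const (y - r)).add_const r
    rw [one_mul] at h
    refine h.congr_of_eventuallyEq (Eventually.of_forall fun t => ?_)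
    simp only [id]
    ring
  have hc : HasDerivAt (fun t : ℝ => (F (t * y + (1 - t) * r)).toReal) (D * (y - r)) 0 := by
    have hD' : HasDerivAt (fun x : ℝ => (F x).toReal) D ((0:ℝ) * y + (1 - 0) * r) := by
      simpa using hD
    exact HasDerivAt.comp (0:ℝ) hD' hlin
  have ht := (hasDerivAt_iff_tendsto_slope.1 hc).mono_left
    (nhdsWithin_mono (0:ℝ) (fun t (ht : t ∈ Ioi (0:ℝ)) => (ne_of_gt ht : t ≠ 0)))
  have : D * (y - r) ≤ (F y).toReal - (F r).toReal := by
    refine le_of_tendsto ht ?_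
    filter_upwards [Ioo_mem_nhdsGT (zero_lt_one' ℝ)] with t ht
    obtain ⟨h1, h2⟩ := conv_real F hconv y r t ht.1.le ht.2.le hy hr
    rw [slope_def_field, div_le_iff₀ (by linarith [ht.1])]
    simp only [zero_mul, zero_add, sub_zero, one_mul]
    nlinarith
  linarith

/-- If `F₁` is finite on an open interval around `r` and differentiable at `r`
(with derivative `D`, read through `toReal`), then for every `ε > 0` the Moreau–Yosida
regularization `F_{1,ε}` is differentiable at `r`, and `|F'_{1,ε}(r)|` increases
monotonically to `|F₁'(r)|` as `ε` decreases to `0`: for `0 < ε₁ ≤ ε₂` one has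
`|F'_{1,ε₂}(r)| ≤ |F'_{1,ε₁}(r)| ≤ |F₁'(r)|`, and `lim_{ε → 0⁺} |F'_{1,ε}(r)| = |F₁'(r)|`. -/
theorem yosida_deriv_monotone_tendsto (F₁ : ℝ → ℝ≥0∞)
    (hconv : ∀ x y t : ℝ, 0 ≤ t → t ≤ 1 →
      F₁ (t * x + (1 - t) * y) ≤ ENNReal.ofReal t * F₁ x + ENNReal.ofReal (1 - t) * F₁ y)
    (hlsc : LowerSemicontinuous F₁) (h0 : F₁ 0 = 0)
    (r : ℝ) (c d : ℝ) (hcr : c < r) (hrd : r < d)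
    (hfin : ∀ x ∈ Set.Ioo c d, F₁ x < ⊤)
    (D : ℝ) (hD : HasDerivAt (fun x : ℝ => (F₁ x).toReal) D r) :
    (∀ ε : ℝ, 0 < ε →
      DifferentiableAt ℝ (fun x : ℝ => (yosida F₁ ε x).toReal) r) ∧
    (∀ ε₁ ε₂ : ℝ, 0 < ε₁ → ε₁ ≤ ε₂ →
      |deriv (fun x : ℝ => (yosida F₁ ε₂ x).toReal) r| ≤
        |deriv (fun x : ℝ => (yosida F₁ ε₁ x).toReal) r| ∧
      |deriv (fun x : ℝ => (yosida F₁ ε₁ x).toReal) r| ≤ |D|) ∧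
    Tendsto (fun ε : ℝ => |deriv (fun x : ℝ => (yosida F₁ ε x).toReal) r|)
      (nhdsWithin 0 (Set.Ioi 0)) (nhds |D|) := by
  have hr : F₁ r ≠ ⊤ := (hfin r ⟨hcr, hrd⟩).ne
  choose! p hpfin hpder hpsub using
    fun (ε : ℝ) (hε : 0 < ε) => yosida_key F₁ hconv hlsc h0 ε hε r
  have hDs := deriv_subgradient F₁ hconv r hr D hD
  have hde : ∀ ε : ℝ, 0 < ε → deriv (fun x : ℝ => (yosida F₁ ε x).toReal) r = p ε :=
    fun ε hε => (hpder ε hε).deriv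
  have hpD : ∀ ε : ℝ, 0 < ε → p ε * p ε ≤ D * p ε := by
    intro ε hε
    have h1 := hpsub ε hε r hr
    have h2 := hDs _ (hpfin ε hε)
    refine le_of_mul_le_mul_left ?_ hε
    linarith
  have habs : ∀ ε : ℝ, 0 < ε → |p ε| ≤ |D| := by
    intro ε hε
    have h := hpD ε hε
    by_contra! hc
    have h1 : D * p ε ≤ |D| * |p ε| := by rw [← abs_mul]; exact le_abs_self _
    have h2 := abs_mul_abs_self (p ε)
    nlinarith [abs_nonneg D, abs_nonneg (p ε)]
  refine ⟨fun ε hε => (hpder ε hε).differentiableAt, ?_, ?_⟩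
  · intro ε₁ ε₂ h1 h12
    have h2 : 0 < ε₂ := h1.trans_le h12
    rw [hde ε₁ h1, hde ε₂ h2]
    refine ⟨?_, habs ε₁ h1⟩
    have a := hpsub ε₁ h1 _ (hpfin ε₂ h2)
    have b := hpsub ε₂ h2 _ (hpfin ε₁ h1)
    have m : 0 ≤ (p ε₁ - p ε₂) * (ε₂ * p ε₂ - ε₁ * p ε₁) := by linarith
    generalize p ε₁ = u at m ⊢
    generalize p ε₂ = v at m ⊢
    by_contra! hc
    have hu := abs_lt.1 hc
    rcases le_or_gt 0 v with hv | hv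
    · rw [abs_of_nonneg hv] at hu
      have k : ε₁ * u < ε₁ * v := mul_lt_mul_of_pos_left hu.2 h1
      have k2 : ε₁ * v ≤ ε₂ * v := mul_le_mul_of_nonneg_right h12 hv
      nlinarith
    · rw [abs_of_neg hv] at hu
      have k : ε₁ * v < ε₁ * u := mul_lt_mul_of_pos_left (by linarith) h1
      have k2 : ε₂ * v ≤ ε₁ * v := mul_le_mul_of_nonpos_right h12 hv.le
      nlinarith
  · have hlim : Tendsto p (nhdsWithin 0 (Set.Ioi 0)) (nhds D) := by
      rw [Metric.tendsto_nhds]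
      intro η hη
      have hδ : 0 < η / 3 := by positivity
      have hb := (hasDerivAt_iff_isLittleO.1 hD).def hδ
      obtain ⟨ρ, hρ, hball⟩ := Metric.eventually_nhds_iff.1
        (hb.and (isOpen_Ioo.mem_nhds (show r ∈ Ioo c d from ⟨hcr, hrd⟩)))
      have hh : 0 < ρ / 2 := by positivity
      set h := ρ / 2 with hh_def
      have hstep : ∀ ε : ℝ, 0 < ε → ∀ y, dist y r < ρ →
          p ε * (y - r) ≤ D * (y - r) + η / 3 * |y - r| + ε * (D ^ 2) := by
        intro ε hε y hy
        obtain ⟨h1, h2⟩ := hball hy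
        have h3 := hpsub ε hε y (hfin y h2).ne
        have h4 := hDs _ (hpfin ε hε)
        rw [Real.norm_eq_abs, Real.norm_eq_abs, smul_eq_mul] at h1
        have h5 := (le_abs_self _).trans h1
        have h6 : D * p ε ≤ D ^ 2 := by
          have k1 : D * p ε ≤ |D| * |p ε| := by rw [← abs_mul]; exact le_abs_self _
          have k2 := mul_le_mul_of_nonneg_left (habs ε hε) (abs_nonneg D)
          rw [abs_mul_abs_self] at k2
          linarith [sq D]
        have h7 : ε * (D * p ε) ≤ ε * D ^ 2 := mul_le_mul_of_nonneg_left h6 hε.le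
        have h8 : 0 ≤ ε * (p ε * p ε) := mul_nonneg hε.le (mul_self_nonneg _)
        linarith
      have hpos : 0 < η / 3 * h / (D ^ 2 + 1) := by positivity
      filter_upwards [Ioo_mem_nhdsGT hpos] with ε hε
      have e1 := hstep ε hε.1 (r + h) (by
        rw [Real.dist_eq, add_sub_cancel_left, abs_of_pos hh]; linarith)
      have e2 := hstep ε hε.1 (r - h) (by
        rw [Real.dist_eq, sub_sub_cancel_left, abs_neg, abs_of_pos hh]; linarith)
      rw [add_sub_cancel_left, abs_of_pos hh] at e1
      rw [sub_sub_cancel_left, abs_neg, abs_of_pos hh] at e2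
      have e3 := (lt_div_iff₀ (by positivity)).1 hε.2
      have e4 := hε.1
      rw [Real.dist_eq, abs_lt]
      constructor
      · refine lt_of_mul_lt_mul_right ?_ hh.le
        nlinarith [mul_pos hη hh]
      · refine lt_of_mul_lt_mul_right ?_ hh.le
        nlinarith [mul_pos hη hh]
    refine hlim.abs.congr' ?_
    filter_upwards [self_mem_nhdsWithin] with ε hε
    rw [hde ε hε]
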